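/- Let (V, q) be a finite-dimensional quadratic space over a field K of characteristic ≠ 2, with q possibly degenerate. Then there exists n ∈ ℕ such that n×q is hyperbolic if and only if sgn_P(q) = 0 for every ordering P of K; and in this case, the smallest such n is a power of 2. -/

import Mathlib

open Module

structure FieldOrdering (K : Type*) [Field K] where
  carrier : Set K
  add_mem' : ∀ ⦃a b : K⦄, a ∈ carrier → b ∈ carrier → a + b ∈ carrier
  mul_mem' : ∀ ⦃a b : K⦄, a ∈ carrier → b ∈ carrier → a * b ∈ carrier
  total' : ∀ a : K, a ≠ 0 → a ∈ carrier ∨ -a ∈ carrier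
  disjoint' : ∀ a : K, a ∈ carrier → -a ∉ carrier

/-- The signature of the (possibly degenerate) quadratic form `Q` with respect to the
ordering `O` of `K`: the largest dimension of a subspace on which `Q` is positive definite
minus the largest dimension of a subspace on which `Q` is negative definite. -/
noncomputable def signatureAt {K V : Type*} [Field K] [AddCommGroup V] [Module K V]
    (O : FieldOrdering K) (Q : V → K) : ℤ :=
  (sSup {n : ℕ | ∃ U : Submodule K V, Module.finrank K U = n ∧
      ∀ v ∈ U, v ≠ 0 → Q v ∈ O.carrier} : ℕ) -
  (sSup {n : ℕ | ∃ U : Submodule K V, Module.finrank K U = n ∧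
      ∀ v ∈ U, v ≠ 0 → -(Q v) ∈ O.carrier} : ℕ)

def IsHyperbolicQ {K V : Type*} [Field K] [AddCommGroup V] [Module K V]
    (Q : V → K) : Prop :=
  ∃ U W : Submodule K V, IsCompl U W ∧ (∀ v ∈ U, Q v = 0) ∧ (∀ v ∈ W, Q v = 0)

def timesQ {K V : Type*} [Field K] [AddCommGroup V] [Module K V] (n : ℕ) (Q : V → K) :
    (Fin n → V) → K := fun v => ∑ j, Q (v j)


section Aux

open LinearMap (BilinForm)

theorem hyp_transport {K V W : Type*} [Field K] [AddCommGroup V] [Module K V]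
    [AddCommGroup W] [Module K W] (e : V ≃ₗ[K] W) {Q : V → K} {Q' : W → K}
    (h : ∀ v, Q' (e v) = Q v) (hQ : IsHyperbolicQ Q) : IsHyperbolicQ Q' := by
  obtain ⟨U, W, hc, hU, hW⟩ := hQ
  refine ⟨U.map e.toLinearMap, W.map e.toLinearMap, ?_, ?_, ?_⟩
  · exact hc.map (Submodule.orderIsoMapComap e)
  · rintro _ ⟨u, hu, rfl⟩
    simpa [h] using hU u hu
  · rintro _ ⟨u, hu, rfl⟩
    simpa [h] using hW u hu

theorem bil_zero_of_quad {K V : Type*} [Field K] (h2 : (2 : K) ≠ 0) [AddCommGroup V] [Module K V]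
    (B : BilinForm K V) (hB : B.IsSymm) (U : Submodule K V) (hU : ∀ v ∈ U, B v v = 0)
    {u v : V} (hu : u ∈ U) (hv : v ∈ U) : B u v = 0 := by
  have h := hU _ (U.add_mem hu hv)
  have hs : B v u = B u v := by simpa using hB.eq v u
  simp only [map_add, LinearMap.add_apply, hU u hu, hU v hv, hs] at h
  have : 2 * B u v = 0 := by linear_combination h
  exact (mul_eq_zero.mp this).resolve_left h2

theorem hyp_to_lag {K V : Type*} [Field K] (h2 : (2 : K) ≠ 0) [AddCommGroup V] [Module K V]
    (B : BilinForm K V) (hB : B.IsSymm) (h : IsHyperbolicQ fun v => B v v) :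
    ∃ L : Submodule K V, B.orthogonal L = L := by
  obtain ⟨U, W, hc, hU, hW⟩ := h
  have hs : ∀ u v, B v u = B u v := fun u v => by simpa using hB.eq v u
  have hUU : U ≤ B.orthogonal U := fun u hu v hv => bil_zero_of_quad h2 B hB U hU hv hu
  refine ⟨B.orthogonal U, le_antisymm (fun v hv => ?_) (fun v hv w hw => ?_)⟩
  · exact fun u hu => hv u (hUU hu)
  · -- both in U^⊥
    have key : ∀ x ∈ B.orthogonal U, ∃ u ∈ U, ∃ r, (∀ y, B y r = 0) ∧ x = u + r := by
      intro x hx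
      obtain ⟨u, hu, r, hr, rfl⟩ := Submodule.mem_sup.mp
        (show x ∈ U ⊔ W by rw [hc.sup_eq_top]; trivial)
      refine ⟨u, hu, r, fun y => ?_, rfl⟩
      obtain ⟨u', hu', r', hr', rfl⟩ := Submodule.mem_sup.mp
        (show y ∈ U ⊔ W by rw [hc.sup_eq_top]; trivial)
      have h1 : B u' (u + r) = 0 := hx u' hu'
      have h3 : B u' u = 0 := hUU hu u' hu'
      have h4 : B r' r = 0 := bil_zero_of_quad h2 B hB W hW hr' hr
      simp only [map_add, LinearMap.add_apply] at *
      rw [h3, zero_add] at h1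
      rw [h1, h4, add_zero]
    obtain ⟨u, hu, r, hr, rfl⟩ := key v hv
    obtain ⟨u', hu', r', hr', rfl⟩ := key w hw
    have h3 : B u' u = 0 := hUU hu u' hu'
    have h5 : B r' u = 0 := by rw [hs]; exact hr' u
    change B (u' + r') (u + r) = 0
    simp only [map_add, LinearMap.add_apply, hr, h3, h5, add_zero]

theorem lag_to_hyp {K V : Type*} [Field K] (h2 : (2 : K) ≠ 0) [AddCommGroup V] [Module K V]
    [FiniteDimensional K V]
    (B : BilinForm K V) (hB : B.IsSymm) (h : ∃ L : Submodule K V, B.orthogonal L = L) :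
    IsHyperbolicQ fun v => B v v := by
  obtain ⟨L, hL⟩ := h
  have hs : ∀ u v, B v u = B u v := fun u v => by simpa using hB.eq v u
  have hLL : ∀ u ∈ L, ∀ v ∈ L, B u v = 0 := fun u hu v hv => by
    rw [← hL] at hv; exact hv u hu
  obtain ⟨C, hC⟩ := L.exists_isCompl
  -- the pairing C → L^*
  let p : C →ₗ[K] Module.Dual K L := (B.domRestrict C).compl₂ L.subtype
  have hp : Function.Injective p := by
    rw [← LinearMap.ker_eq_bot, LinearMap.ker_eq_bot']
    intro c hc
    have : (c : V) ∈ L := by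
      rw [← hL]
      intro l hl
      have : p c ⟨l, hl⟩ = 0 := by rw [hc]; rfl
      change B l c = 0
      rw [hs]
      simpa [p] using this
    have := (Submodule.disjoint_def.mp hC.disjoint) _ this c.2
    exact Subtype.ext this
  have hps : Function.Surjective (p.dualMap ∘ₗ (Module.evalEquiv K L).toLinearMap) := by
    rw [LinearMap.coe_comp]
    exact (LinearMap.dualMap_surjective_iff.mpr hp).comp (Module.evalEquiv K L).surjective
  obtain ⟨g, hg⟩ := LinearMap.exists_rightInverse_of_surjective _ (LinearMap.range_eq_top.mpr hps)
  have hg' : ∀ (f : Module.Dual K C) (c : C), B c (g f : V) = f c := by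
    intro f c
    have := congrArg (fun F => F f c) hg
    simpa [p] using this
  let f : C →ₗ[K] L := g ∘ₗ ((-(2:K)⁻¹) • ((B.domRestrict C).compl₂ C.subtype))
  have hf : ∀ c c' : C, B c' (f c : V) = -(2:K)⁻¹ * B c c' := by
    intro c c'
    simp only [f, LinearMap.comp_apply, hg']
    simp
  refine ⟨L, LinearMap.range (C.subtype + L.subtype ∘ₗ f), ?_, fun v hv => hLL v hv v hv, ?_⟩
  · constructor
    · rw [Submodule.disjoint_def]
      rintro _ hx ⟨c, rfl⟩
      have hcL : (c : V) ∈ L := by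
        have := L.sub_mem hx (f c).2
        simpa using this
      have h0 : c = 0 := Subtype.ext ((Submodule.disjoint_def.mp hC.disjoint) _ hcL c.2)
      simp [h0]
    · rw [codisjoint_iff, eq_top_iff]
      intro v _
      obtain ⟨l, hl, c, hc, rfl⟩ := Submodule.mem_sup.mp
        (show v ∈ L ⊔ C by rw [hC.sup_eq_top]; trivial)
      refine Submodule.mem_sup.mpr ⟨l - f ⟨c, hc⟩, L.sub_mem hl (f ⟨c, hc⟩).2, _, ⟨⟨c, hc⟩, rfl⟩, ?_⟩
      simp
  · rintro _ ⟨c, rfl⟩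
    have h3 := hLL _ (f c).2 _ (f c).2
    have h4 := hf c c
    have h5 := hs (c : V) (f c : V)
    simp only [LinearMap.add_apply, LinearMap.comp_apply, Submodule.subtype_apply, map_add, h3]
    rw [h5, h4]
    field_simp
    ring

theorem orth_orth {K V : Type*} [Field K] [AddCommGroup V] [Module K V]
    [FiniteDimensional K V] (B : BilinForm K V) (hB : B.IsSymm) (N : Submodule K V)
    (hN : LinearMap.ker B ≤ N) : B.orthogonal (B.orthogonal N) = N := by
  symm
  apply Submodule.eq_of_le_of_finrank_le (BilinForm.le_orthogonal_orthogonal hB.isRefl)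
  have h1 := BilinForm.finrank_add_finrank_orthogonal' (B := B) N
  have h2 := BilinForm.finrank_add_finrank_orthogonal' (B := B) (B.orthogonal N)
  have hk : LinearMap.ker B ≤ B.orthogonal N := by
    rw [← BilinForm.orthogonal_top_eq_ker hB.isRefl]
    exact BilinForm.orthogonal_le le_top
  rw [inf_eq_right.mpr hN] at h1
  rw [inf_eq_right.mpr hk] at h2
  omega

theorem lag_cancel {K V W : Type*} [Field K] [AddCommGroup V] [Module K V] [AddCommGroup W]
    [Module K W] [FiniteDimensional K V] [FiniteDimensional K W]
    (A : BilinForm K V) (C : BilinForm K W) (B : BilinForm K (V × W)) (hB : B.IsSymm)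
    (hBA : ∀ x y, B x y = A x.1 y.1 + C x.2 y.2)
    (h : ∃ L : Submodule K (V × W), B.orthogonal L = L)
    (hM : ∃ M : Submodule K W, C.orthogonal M = M) :
    ∃ L : Submodule K V, A.orthogonal L = L := by
  obtain ⟨L, hL⟩ := h
  obtain ⟨M, hM⟩ := hM
  have hLL : ∀ u ∈ L, ∀ v ∈ L, B u v = 0 := fun u hu v hv => by
    rw [← hL] at hv; exact hv u hu
  have hMM : ∀ u ∈ M, ∀ v ∈ M, C u v = 0 := fun u hu v hv => by
    rw [← hM] at hv; exact hv u hu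
  let S : Submodule K (V × W) := L ⊓ M.comap (LinearMap.snd K V W)
  refine ⟨S.map (LinearMap.fst K V W), le_antisymm ?_ ?_⟩
  · intro v hv
    let N : Submodule K (V × W) := L ⊔ M.map (LinearMap.inr K V W)
    have hkN : LinearMap.ker B ≤ N := by
      refine le_trans ?_ (le_sup_left : L ≤ N)
      rw [← BilinForm.orthogonal_top_eq_ker hB.isRefl]
      conv_rhs => rw [← hL]
      exact BilinForm.orthogonal_le le_top
    have hNS : B.orthogonal N ≤ S := by
      intro x hx
      refine ⟨?_, ?_⟩
      · rw [← hL]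
        exact fun l hl => hx l (le_sup_left (a := L) hl)
      · change x.2 ∈ M
        rw [← hM]
        intro m hm
        have : B (0, m) x = 0 := hx _ (le_sup_right (a := L) ⟨m, hm, rfl⟩)
        simpa [hBA] using this
    have hvN : ((v, 0) : V × W) ∈ N := by
      rw [← orth_orth B hB N hkN]
      intro x hx
      change B x (v, 0) = 0
      have : A x.1 v = 0 := hv x.1 ⟨x, hNS hx, rfl⟩
      simp [hBA, this]
    obtain ⟨l, hl, _, ⟨m, hm, rfl⟩, hlm⟩ := Submodule.mem_sup.mp hvN
    refine ⟨l, ⟨hl, ?_⟩, ?_⟩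
    · change l.2 ∈ M
      have : l.2 + m = 0 := by simpa using congrArg Prod.snd hlm
      rw [eq_neg_of_add_eq_zero_left this]
      exact M.neg_mem hm
    · simpa using congrArg Prod.fst hlm
  · rintro _ ⟨x, ⟨hxL, hxM⟩, rfl⟩ _ ⟨y, ⟨hyL, hyM⟩, rfl⟩
    have h1 := hLL y hyL x hxL
    rw [hBA, hMM y.2 hyM x.2 hxM, add_zero] at h1
    exact h1


def dQ {K ι : Type*} [Field K] [Fintype ι] (a : ι → K) : (ι → K) → K :=
  fun x => ∑ i, a i * (x i * x i)

def HypD {K ι : Type*} [Field K] [Fintype ι] (a : ι → K) : Prop := IsHyperbolicQ (dQ a)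

def dB {K ι : Type*} [Field K] [Fintype ι] (a : ι → K) : BilinForm K (ι → K) :=
  LinearMap.mk₂ K (fun x y => ∑ i, a i * (x i * y i))
    (fun x x' y => by simp [← Finset.sum_add_distrib, add_mul, mul_add])
    (fun c x y => by
      simp only [Pi.smul_apply, smul_eq_mul, Finset.mul_sum]
      exact Finset.sum_congr rfl fun i _ => by ring)
    (fun x y y' => by simp [← Finset.sum_add_distrib, mul_add])
    (fun c x y => by
      simp only [Pi.smul_apply, smul_eq_mul, Finset.mul_sum]
      exact Finset.sum_congr rfl fun i _ => by ring)

theorem dB_apply {K ι : Type*} [Field K] [Fintype ι] (a x y : ι → K) :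
    dB a x y = ∑ i, a i * (x i * y i) := rfl

theorem dB_symm {K ι : Type*} [Field K] [Fintype ι] (a : ι → K) : (dB a).IsSymm :=
  ⟨fun x y => by simp [dB_apply, mul_comm (x _)]⟩

theorem hypD_reindex {K ι κ : Type*} [Field K] [Fintype ι] [Fintype κ] (e : ι ≃ κ)
    {a : ι → K} {b : κ → K} (h : ∀ i, b (e i) = a i) (ha : HypD a) : HypD b := by
  refine hyp_transport (LinearEquiv.funCongrLeft K K e.symm) (fun v => ?_) ha
  simp only [dQ]
  rw [← e.sum_comp]
  simp [h, LinearEquiv.funCongrLeft_apply, LinearMap.funLeft_apply]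

theorem hypD_smul {K ι : Type*} [Field K] [Fintype ι] (c : K) {a : ι → K} (ha : HypD a) :
    HypD (fun i => c * a i) := by
  obtain ⟨U, W, hc, hU, hW⟩ := ha
  have : ∀ x, dQ (fun i => c * a i) x = c * dQ a x := fun x => by
    simp [dQ, Finset.mul_sum, mul_assoc]
  exact ⟨U, W, hc, fun v hv => by rw [this, hU v hv, mul_zero],
    fun v hv => by rw [this, hW v hv, mul_zero]⟩

theorem hyp_prod {K V W : Type*} [Field K] [AddCommGroup V] [Module K V] [AddCommGroup W]
    [Module K W] {Q : V → K} {Q' : W → K} (h : IsHyperbolicQ Q) (h' : IsHyperbolicQ Q') :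
    IsHyperbolicQ (fun x : V × W => Q x.1 + Q' x.2) := by
  obtain ⟨U, W, hc, hU, hW⟩ := h
  obtain ⟨U', W', hc', hU', hW'⟩ := h'
  refine ⟨U.prod U', W.prod W', ⟨?_, ?_⟩, ?_, ?_⟩
  · rw [disjoint_iff, Submodule.prod_inf_prod, hc.inf_eq_bot, hc'.inf_eq_bot, Submodule.prod_bot]
  · rw [codisjoint_iff, Submodule.prod_sup_prod, hc.sup_eq_top, hc'.sup_eq_top, Submodule.prod_top]
  · rintro ⟨x, y⟩ ⟨hx, hy⟩
    simp [hU x hx, hU' y hy]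
  · rintro ⟨x, y⟩ ⟨hx, hy⟩
    simp [hW x hx, hW' y hy]

theorem hypD_sum {K ι κ : Type*} [Field K] [Fintype ι] [Fintype κ]
    {a : ι → K} {b : κ → K} (ha : HypD a) (hb : HypD b) : HypD (Sum.elim a b) := by
  refine hyp_transport (LinearEquiv.sumArrowLequivProdArrow ι κ K K).symm (fun v => ?_)
    (hyp_prod ha hb)
  simp [dQ, Fintype.sum_sum_type, LinearEquiv.sumArrowLequivProdArrow]
  rfl

theorem hypD_cancel {K ι κ : Type*} [Field K] (h2 : (2 : K) ≠ 0) [Fintype ι] [Fintype κ]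
    {a : ι → K} {b : κ → K} (hab : HypD (Sum.elim a b)) (hb : HypD b) : HypD a := by
  let B : BilinForm K ((ι → K) × (κ → K)) :=
    (dB a).compl₁₂ (LinearMap.fst _ _ _) (LinearMap.fst _ _ _) +
    (dB b).compl₁₂ (LinearMap.snd _ _ _) (LinearMap.snd _ _ _)
  have hBA : ∀ x y, B x y = dB a x.1 y.1 + dB b x.2 y.2 := fun x y => rfl
  have hB : B.IsSymm := ⟨fun x y => by
    have h1 := (dB_symm a).eq x.1 y.1
    have h3 := (dB_symm b).eq x.2 y.2
    rw [hBA, hBA, h1, h3]⟩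
  refine lag_to_hyp h2 (dB a) (dB_symm a) (lag_cancel (dB a) (dB b) B hB hBA ?_ ?_)
  · apply hyp_to_lag h2 B hB
    refine hyp_transport (LinearEquiv.sumArrowLequivProdArrow ι κ K K) (fun v => ?_) hab
    simp [hBA, dB_apply, dQ, Fintype.sum_sum_type, LinearEquiv.sumArrowLequivProdArrow]
  · exact hyp_to_lag h2 (dB b) (dB_symm b) hb

theorem hypD_isom {K ι κ : Type*} [Field K] (h2 : (2 : K) ≠ 0) [Fintype ι] [Fintype κ]
    {a : ι → K} {b : κ → K} (g : (ι → K) ≃ₗ[K] (κ → K)) (hg : ∀ x, dQ b (g x) = dQ a x) :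
    HypD (Sum.elim a (fun j => - b j)) := by
  have key : IsHyperbolicQ (fun x : (ι → K) × (κ → K) => dQ a x.1 - dQ b x.2) := by
    refine ⟨LinearMap.range (LinearMap.prod LinearMap.id g.toLinearMap),
      LinearMap.range (LinearMap.prod LinearMap.id (-g.toLinearMap)), ⟨?_, ?_⟩, ?_, ?_⟩
    · rw [Submodule.disjoint_def]
      rintro _ ⟨x, rfl⟩ ⟨y, hy⟩
      have h1 : y = x := by simpa using congrArg Prod.fst hy
      have h3 : - g y = g x := by simpa using congrArg Prod.snd hy
      rw [h1] at h3
      have h4 : (2 : K) • g x = 0 := by rw [two_smul]; nth_rw 1 [← h3]; simp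
      have h5 : g x = 0 := (smul_eq_zero.mp h4).resolve_left h2
      have h6 : x = 0 := by simpa using h5
      simp [h6]
    · rw [codisjoint_iff, eq_top_iff]
      rintro ⟨x, y⟩ _
      refine Submodule.mem_sup.mpr ⟨_, ⟨(2:K)⁻¹ • (x + g.symm y), rfl⟩, _,
        ⟨(2:K)⁻¹ • (x - g.symm y), rfl⟩, ?_⟩
      have e1 : (2:K)⁻¹ + 2⁻¹ = 1 := by field_simp; norm_num
      ext i
      · simp
        linear_combination (x i) * e1
      · simp
        linear_combination (y i) * e1
    · rintro _ ⟨x, rfl⟩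
      simp [hg]
    · rintro _ ⟨x, rfl⟩
      have : dQ b (-g x) = dQ b (g x) := by simp [dQ]
      change dQ a x - dQ b (-g x) = 0
      rw [this, hg, sub_self]
  refine hyp_transport (LinearEquiv.sumArrowLequivProdArrow ι κ K K).symm (fun v => ?_) key
  simp [dQ, Fintype.sum_sum_type, LinearEquiv.sumArrowLequivProdArrow, sub_eq_add_neg]
  rfl

theorem hypD_neg {K ι : Type*} [Field K] (h2 : (2 : K) ≠ 0) [Fintype ι] (a : ι → K) :
    HypD (Sum.elim a (fun j => - a j)) :=
  hypD_isom h2 (LinearEquiv.refl _ _) fun _ => rfl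

theorem hypD_zero {K ι : Type*} [Field K] [Fintype ι] (a : ι → K) (h : ∀ i, a i = 0) :
    HypD a :=
  ⟨⊤, ⊥, isCompl_top_bot, fun v _ => by simp [dQ, h], fun v _ => by simp [dQ, h]⟩

theorem hypD_sq {K : Type*} [Field K] (h2 : (2 : K) ≠ 0) (a c : K) (hc : c ≠ 0) :
    HypD (Sum.elim (fun _ : Unit => a * (c * c)) (fun _ : Unit => -a)) := by
  refine hypD_isom h2 (LinearEquiv.smulOfNeZero K (Unit → K) c hc) fun x => ?_
  simp [dQ]
  ring

theorem hypD_add {K : Type*} [Field K] (h2 : (2 : K) ≠ 0) (a b : K) (hc : a + b ≠ 0) :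
    HypD (Sum.elim (![a + b, a * b * (a + b)]) (fun j => -(![a, b] j))) := by
  let f : (Fin 2 → K) →ₗ[K] (Fin 2 → K) := Matrix.toLin' !![1, b; 1, -a]
  have hf : ∀ x, f x = ![x 0 + b * x 1, x 0 - a * x 1] := fun x => by
    ext i
    fin_cases i <;> simp [f, Matrix.mulVec, dotProduct, Fin.sum_univ_two, sub_eq_add_neg]
  have hinj : Function.Injective f := by
    rw [← LinearMap.ker_eq_bot, LinearMap.ker_eq_bot']
    intro x hx
    rw [hf] at hx
    have e0 : x 0 + b * x 1 = 0 := by simpa using congrFun hx 0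
    have e1 : x 0 - a * x 1 = 0 := by simpa using congrFun hx 1
    have e2 : (a + b) * x 1 = 0 := by linear_combination e0 - e1
    have e3 := (mul_eq_zero.mp e2).resolve_left hc
    have e4 : x 0 = 0 := by simpa [e3] using e0
    ext i
    fin_cases i <;> simp [e3, e4]
  refine hypD_isom h2 (LinearEquiv.ofInjectiveEndo f hinj) fun x => ?_
  rw [LinearEquiv.coe_ofInjectiveEndo, hf]
  simp [dQ, Fin.sum_univ_two]
  ring


open Classical in
noncomputable def osgn {K : Type*} [Field K] (O : FieldOrdering K) (a : K) : ℤ :=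
  if a ∈ O.carrier then 1 else if -a ∈ O.carrier then -1 else 0

theorem pfister_abstract {K R : Type*} [Field K] [CommRing R] (φ : K →* R) (H : Ideal R)
    (r0 : φ 0 ∈ H) (rsq : ∀ a, a ≠ 0 → φ (a * a) - 1 ∈ H) (rneg : ∀ a, φ a + φ (-a) ∈ H)
    (radd : ∀ a b, a + b ≠ 0 → φ (a + b) + φ (a * b * (a + b)) - (φ a + φ b) ∈ H)
    {ι : Type*} [Fintype ι] (a : ι → K)
    (hO : ∀ O : FieldOrdering K, ∑ i, osgn O (a i) = 0) :
    ∃ k : ℕ, 2 ^ k * ∑ i, φ (a i) ∈ H := by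
  by_contra! hcon
  set x := ∑ i, φ (a i) with hx
  obtain ⟨I, hHI, hI, hmax⟩ := zorn_le_nonempty₀ {I : Ideal R | ∀ k : ℕ, 2 ^ k * x ∉ I} (by
    intro c hc hchain y hy
    refine ⟨sSup c, fun k hk => ?_, fun z hz => le_sSup hz⟩
    rw [Submodule.mem_sSup_of_directed ⟨y, hy⟩ hchain.directedOn] at hk
    obtain ⟨z, hz, hkz⟩ := hk
    exact hc hz k hkz) H hcon
  let π := Ideal.Quotient.mk I
  let ψ : K → R ⧸ I := fun a => π (φ a)
  have hm : ∀ {r}, r ∈ H → π r = 0 := fun h => Ideal.Quotient.eq_zero_iff_mem.mpr (hHI h)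
  have hx2 : ∀ k : ℕ, 2 ^ k * π x ≠ 0 := fun k h => hI k (Ideal.Quotient.eq_zero_iff_mem.mp (by
    rw [map_mul, map_pow, map_ofNat]; exact h))
  have q0 : ψ 0 = 0 := hm r0
  have qmul : ∀ a b, ψ (a * b) = ψ a * ψ b := fun a b => by simp [ψ]
  have qsq : ∀ a, a ≠ 0 → ψ a * ψ a = 1 := fun a ha => by
    have := hm (rsq a ha)
    rw [map_sub, map_one, sub_eq_zero] at this
    rw [← qmul]; exact this
  have qneg : ∀ a, ψ (-a) = - ψ a := fun a => by
    have := hm (rneg a)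
    rw [map_add] at this
    exact eq_neg_of_add_eq_zero_right this
  have qadd : ∀ a b, a + b ≠ 0 → ψ (a + b) + ψ a * ψ b * ψ (a + b) = ψ a + ψ b := fun a b h => by
    have := hm (radd a b h)
    rw [map_sub, map_add π, map_add π, sub_eq_zero] at this
    rw [← qmul, ← qmul]; exact this
  have two_ne : ∀ k : ℕ, (2 : R ⧸ I) ^ k ≠ 0 := fun k h => hx2 k (by rw [h, zero_mul])
  have step : ∀ r : R, r ∉ I → ∃ k : ℕ, ∃ s : R, 2 ^ k * π x = π s * π r := by
    intro r hr
    by_contra! hno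
    have hlt : I ⊔ Ideal.span {r} ∈ {I : Ideal R | ∀ k : ℕ, 2 ^ k * x ∉ I} := by
      intro k hk
      obtain ⟨y, hy, z, hz, hyz⟩ := Submodule.mem_sup.mp hk
      obtain ⟨s, rfl⟩ := Ideal.mem_span_singleton'.mp hz
      apply hno k s
      have := congrArg π hyz
      rw [map_add, map_mul, map_mul, map_pow, map_ofNat,
        (Ideal.Quotient.eq_zero_iff_mem (I := I)).mpr hy, zero_add] at this
      exact this.symm
    exact hr (hmax hlt le_sup_left (Ideal.mem_sup_right (Ideal.mem_span_singleton_self r)))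
  have dich : ∀ a, a ≠ 0 → ψ a = 1 ∨ ψ a = -1 := by
    intro a ha
    by_contra! hn
    have h1 : (φ a - 1) ∉ I := fun h => hn.1 (by
      have := (Ideal.Quotient.eq_zero_iff_mem (I := I)).mpr h
      rw [map_sub, map_one, sub_eq_zero] at this
      exact this)
    have h3 : (φ a + 1) ∉ I := fun h => hn.2 (by
      have := (Ideal.Quotient.eq_zero_iff_mem (I := I)).mpr h
      rw [map_add, map_one] at this
      exact eq_neg_of_add_eq_zero_left this)
    obtain ⟨k, s, hk⟩ := step _ h1
    obtain ⟨l, t, hl⟩ := step _ h3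
    rw [map_sub, map_one] at hk
    rw [map_add, map_one] at hl
    change _ = π s * (ψ a - 1) at hk
    change _ = π t * (ψ a + 1) at hl
    apply hx2 (k + l + 1)
    have e := qsq a ha
    have e1 : 2 ^ k * π x * (ψ a + 1) = 0 := by rw [hk]; linear_combination π s * e
    have e2 : 2 ^ l * π x * (ψ a - 1) = 0 := by rw [hl]; linear_combination π t * e
    rw [pow_add, pow_add]
    linear_combination 2 ^ l * e1 - 2 ^ k * e2
  have nboth : ∀ a, ψ a = 1 → ψ a ≠ -1 := fun a h h' => two_ne 1 (by
    rw [h] at h'; linear_combination h')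
  have ne0 : ∀ a, ψ a = 1 → a ≠ 0 := by
    rintro _ h rfl
    rw [q0] at h
    exact two_ne 1 (by linear_combination -2 * h)
  let O : FieldOrdering K :=
    { carrier := {a | ψ a = 1}
      add_mem' := by
        intro a b ha hb
        change ψ a = 1 at ha
        change ψ b = 1 at hb
        change ψ (a + b) = 1
        have hab : a + b ≠ 0 := by
          intro h
          have : b = -a := by linear_combination h
          rw [this, qneg] at hb
          exact nboth a ha (by linear_combination -hb)
        rcases dich _ hab with h | h
        · exact h
        · have := qadd a b hab
          rw [ha, hb, h] at this
          exact absurd (show (2 : R ⧸ I) ^ 2 = 0 by linear_combination -this) (two_ne 2)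
      mul_mem' := by
        intro a b ha hb
        change ψ a = 1 at ha
        change ψ b = 1 at hb
        change ψ (a * b) = 1
        rw [qmul, ha, hb, one_mul]
      total' := by
        intro a ha
        rcases dich a ha with h | h
        · exact Or.inl h
        · right
          change ψ (-a) = 1
          rw [qneg, h, neg_neg]
      disjoint' := by
        intro a ha h
        change ψ a = 1 at ha
        change ψ (-a) = 1 at h
        rw [qneg] at h
        exact nboth a ha (by linear_combination -h) }
  have hval : ∀ a, ψ a = (osgn O a : ℤ) := by
    intro a
    unfold osgn
    have i1 : a ∈ O.carrier ↔ ψ a = 1 := Iff.rfl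
    have i2 : -a ∈ O.carrier ↔ ψ (-a) = 1 := Iff.rfl
    rw [i1, i2, qneg]
    by_cases ha : a = 0
    · have n1 : ¬ ψ a = 1 := fun h => ne0 a h ha
      have n2 : ¬ -ψ a = 1 := fun h => ne0 (-a) (by rw [qneg]; exact h) (by simp [ha])
      rw [if_neg n1, if_neg n2, ha, q0]; simp
    · rcases dich a ha with h | h
      · rw [if_pos h, h]; simp
      · have n1 : ¬ ψ a = 1 := fun h' => nboth a h' h
        rw [if_neg n1, if_pos (by rw [h, neg_neg]), h]; simp
  apply hx2 0
  have : π x = ((∑ i, osgn O (a i) : ℤ) : R ⧸ I) := by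
    rw [hx, map_sum, Int.cast_sum]
    exact Finset.sum_congr rfl fun i _ => hval (a i)
  rw [this, hO O]; simp

noncomputable def fam {K ι : Type*} [Field K] [Fintype ι] (a : ι → K) : MonoidAlgebra ℤ K :=
  ∑ i, MonoidAlgebra.of ℤ K (a i)

theorem fam_sum {K ι κ : Type*} [Field K] [Fintype ι] [Fintype κ] (a : ι → K) (b : κ → K) :
    fam (Sum.elim a b) = fam a + fam b := by
  simp [fam, Fintype.sum_sum_type]

theorem fam_inj {K ι κ : Type*} [Field K] [Fintype ι] [Fintype κ] (a : ι → K) (b : κ → K)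
    (h : fam a = fam b) : ∃ e : ι ≃ κ, ∀ i, b (e i) = a i := by
  classical
  have hc : ∀ c, Fintype.card {i // a i = c} = Fintype.card {j // b j = c} := by
    intro c
    have := congrArg (fun f => f.coeff c) h
    simp only [fam, MonoidAlgebra.coeff_sum, MonoidAlgebra.of_apply, MonoidAlgebra.coeff_single,
      Finsupp.finsetSum_apply, Finsupp.single_apply, Finset.sum_boole] at this
    rw [Fintype.card_subtype, Fintype.card_subtype]
    exact_mod_cast this
  exact ⟨Equiv.ofFiberEquiv fun c => Fintype.equivOfCardEq (hc c), Equiv.ofFiberEquiv_map _⟩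

def hypSet (K : Type*) [Field K] : Set (MonoidAlgebra ℤ K) :=
  {f | ∃ (ι κ : Type) (_ : Fintype ι) (_ : Fintype κ) (a : ι → K) (b : κ → K),
    f = fam a - fam b ∧ HypD (Sum.elim a fun j => - b j)}

theorem hypSet_add {K : Type*} [Field K] {f g : MonoidAlgebra ℤ K} (hf : f ∈ hypSet K)
    (hg : g ∈ hypSet K) : f + g ∈ hypSet K := by
  obtain ⟨ι, κ, _, _, a, b, rfl, h⟩ := hf
  obtain ⟨ι', κ', _, _, a', b', rfl, h'⟩ := hg
  refine ⟨ι ⊕ ι', κ ⊕ κ', inferInstance, inferInstance, Sum.elim a a', Sum.elim b b', ?_, ?_⟩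
  · rw [fam_sum, fam_sum]; abel
  · refine hypD_reindex (Equiv.sumSumSumComm ι κ ι' κ') ?_ (hypD_sum h h')
    rintro ((i | i) | (i | i)) <;> rfl

theorem hypSet_neg {K : Type*} [Field K] {f : MonoidAlgebra ℤ K} (hf : f ∈ hypSet K) :
    -f ∈ hypSet K := by
  obtain ⟨ι, κ, _, _, a, b, rfl, h⟩ := hf
  refine ⟨κ, ι, inferInstance, inferInstance, b, a, by abel, ?_⟩
  refine hypD_reindex (Equiv.sumComm ι κ) ?_ (hypD_smul (-1) h)
  rintro (i | i) <;> simp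

theorem hypSet_zero {K : Type*} [Field K] : (0 : MonoidAlgebra ℤ K) ∈ hypSet K :=
  ⟨Empty, Empty, inferInstance, inferInstance, Empty.elim, Empty.elim, by simp,
    hypD_zero _ (by rintro (i | i) <;> exact i.elim)⟩

theorem hypSet_of_mul {K : Type*} [Field K] (c : K) {f : MonoidAlgebra ℤ K} (hf : f ∈ hypSet K) :
    MonoidAlgebra.of ℤ K c * f ∈ hypSet K := by
  obtain ⟨ι, κ, _, _, a, b, rfl, h⟩ := hf
  refine ⟨ι, κ, inferInstance, inferInstance, fun i => c * a i, fun i => c * b i, ?_, ?_⟩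
  · simp only [fam, map_mul, mul_sub, Finset.mul_sum]
  · convert hypD_smul c h using 1
    ext (i | i) <;> simp

def hypGrp (K : Type*) [Field K] : AddSubgroup (MonoidAlgebra ℤ K) where
  carrier := hypSet K
  add_mem' := hypSet_add
  zero_mem' := hypSet_zero
  neg_mem' := hypSet_neg

def hypIdeal (K : Type*) [Field K] : Ideal (MonoidAlgebra ℤ K) where
  carrier := hypSet K
  add_mem' := hypSet_add
  zero_mem' := hypSet_zero
  smul_mem' := by
    intro r f hf
    rw [smul_eq_mul]
    induction r using MonoidAlgebra.induction_on with
    | of c => exact hypSet_of_mul c hf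
    | add x y hx hy => rw [add_mul]; exact hypSet_add hx hy
    | smul n x hx => rw [smul_mul_assoc]; exact (hypGrp K).zsmul_mem hx n

theorem fam_mem_iff {K : Type*} {ι : Type} [Field K] (h2 : (2 : K) ≠ 0) [Fintype ι] (a : ι → K) :
    fam a ∈ hypIdeal K ↔ HypD a := by
  constructor
  · rintro ⟨ι', κ, _, _, u, t, h, hu⟩
    have : fam (Sum.elim a t) = fam u := by rw [fam_sum, h]; abel
    obtain ⟨e, he⟩ := fam_inj _ _ this
    have h1 : HypD (Sum.elim (Sum.elim a t) fun j => - t j) := by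
      refine hypD_reindex (Equiv.sumCongr e.symm (Equiv.refl κ)) ?_ hu
      rintro (i | i)
      · simp only [Equiv.sumCongr_apply, Sum.map_inl, Sum.elim_inl]
        rw [← he, e.apply_symm_apply]
      · rfl
    have h3 : HypD (Sum.elim a (Sum.elim t fun j => - t j)) := by
      refine hypD_reindex (Equiv.sumAssoc ι κ κ) ?_ h1
      rintro ((i | i) | i) <;> rfl
    exact hypD_cancel h2 h3 (hypD_neg h2 t)
  · intro h
    refine ⟨ι, Empty, inferInstance, inferInstance, a, Empty.elim, by simp [fam], ?_⟩
    refine hypD_reindex (Equiv.sumEmpty ι Empty).symm ?_ h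
    intro i; rfl

theorem pfister_fam {K : Type*} {ι : Type} [Field K] (h2 : (2 : K) ≠ 0) [Fintype ι] (a : ι → K)
    (hO : ∀ O : FieldOrdering K, ∑ i, osgn O (a i) = 0) :
    ∃ k : ℕ, 2 ^ k * fam a ∈ hypIdeal K := by
  have hu : ∀ c : K, fam (fun _ : Unit => c) = MonoidAlgebra.of ℤ K c := fun c => by simp [fam]
  refine pfister_abstract (MonoidAlgebra.of ℤ K) (hypIdeal K) ?_ ?_ ?_ ?_ a hO
  · rw [← hu, fam_mem_iff h2]
    exact hypD_zero _ fun _ => rfl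
  · intro c hc
    have := hypD_sq h2 1 c hc
    rw [one_mul] at this
    rw [← map_one (MonoidAlgebra.of ℤ K), ← hu, ← hu]
    exact ⟨Unit, Unit, inferInstance, inferInstance, _, _, rfl, this⟩
  · intro c
    rw [← hu, ← hu, ← fam_sum, fam_mem_iff h2]
    exact hypD_neg h2 fun _ : Unit => c
  · intro c d hcd
    have e1 : ∀ c d : K, fam ![c, d] = MonoidAlgebra.of ℤ K c + MonoidAlgebra.of ℤ K d :=
      fun c d => by simp [fam, Fin.sum_univ_two]
    rw [← e1, ← e1]
    exact ⟨Fin 2, Fin 2, inferInstance, inferInstance, _, _, rfl, hypD_add h2 c d hcd⟩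


theorem ord_zero {K : Type*} [Field K] (O : FieldOrdering K) : (0 : K) ∉ O.carrier := fun h =>
  O.disjoint' 0 h (by simpa using h)

theorem ord_sq {K : Type*} [Field K] (O : FieldOrdering K) {r : K} (hr : r ≠ 0) :
    r * r ∈ O.carrier := by
  rcases O.total' r hr with h | h
  · exact O.mul_mem' h h
  · simpa using O.mul_mem' h h

theorem ord_sum {K ι : Type*} [Field K] (O : FieldOrdering K) (s : Finset ι) (t : ι → K)
    (h : ∀ i ∈ s, t i ∈ O.carrier ∨ t i = 0) :
    ∑ i ∈ s, t i ∈ O.carrier ∨ (∑ i ∈ s, t i = 0 ∧ ∀ i ∈ s, t i = 0) := by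
  classical
  induction s using Finset.induction_on with
  | empty => right; simp
  | insert j s hj ih =>
    rw [Finset.sum_insert hj]
    have h1 := h j (Finset.mem_insert_self j s)
    have h3 := ih fun i hi => h i (Finset.mem_insert_of_mem hi)
    rcases h1 with h1 | h1 <;> rcases h3 with h3 | ⟨h3, h4⟩
    · exact Or.inl (O.add_mem' h1 h3)
    · left; rwa [h3, add_zero]
    · left; rwa [h1, zero_add]
    · right
      refine ⟨by rw [h1, h3, add_zero], fun i hi => ?_⟩
      rcases Finset.mem_insert.mp hi with rfl | hi
      · exact h1
      · exact h4 i hi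

open Classical in
theorem sylv_pos {K V ι : Type*} [Field K] [AddCommGroup V] [Module K V] [Fintype ι]
    (O : FieldOrdering K) (b : Module.Basis ι K V) (a : ι → K) (Q : V → K)
    (hQ : ∀ v, Q v = ∑ i, a i * (b.repr v i * b.repr v i)) :
    sSup {n : ℕ | ∃ U : Submodule K V, Module.finrank K U = n ∧
      ∀ v ∈ U, v ≠ 0 → Q v ∈ O.carrier} =
      (Finset.univ.filter fun i => a i ∈ O.carrier).card := by
  have : FiniteDimensional K V := b.finiteDimensional_of_finite
  have hfr : ∀ s : Set ι, Module.finrank K (Submodule.span K (b '' s)) = s.toFinset.card := by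
    intro s
    rw [finrank_span_set_eq_card (b.linearIndependent.linearIndepOn_id.mono
      (Set.image_subset_range b s)), Set.toFinset_image,
      Finset.card_image_of_injective _ b.injective]
  have hz : ∀ (s : Set ι) (v : V), v ∈ Submodule.span K (b '' s) → ∀ i ∉ s, b.repr v i = 0 := by
    intro s v hv i hi
    have := b.mem_span_image.mp hv
    by_contra h
    exact hi (this (by simpa using h))
  let s : Set ι := {i | a i ∈ O.carrier}
  have hs : (Finset.univ.filter fun i => a i ∈ O.carrier) = s.toFinset := by
    ext; simp [s]
  rw [hs]
  refine IsGreatest.csSup_eq ⟨⟨Submodule.span K (b '' s), hfr s, fun v hv hv0 => ?_⟩, ?_⟩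
  · rw [hQ]
    have hterm : ∀ i ∈ Finset.univ, a i * (b.repr v i * b.repr v i) ∈ O.carrier ∨
        a i * (b.repr v i * b.repr v i) = 0 := by
      intro i _
      by_cases hi : i ∈ s
      · by_cases h0 : b.repr v i = 0
        · right; simp [h0]
        · left; exact O.mul_mem' hi (ord_sq O h0)
      · right; simp [hz s v hv i hi]
    rcases ord_sum O Finset.univ (fun i => a i * (b.repr v i * b.repr v i)) hterm
      with h | ⟨_, h⟩
    · exact h
    · exfalso
      apply hv0
      apply b.repr.injective
      ext i
      rw [map_zero, Finsupp.zero_apply]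
      by_cases hi : i ∈ s
      · have h1 := h i (Finset.mem_univ i)
        rcases mul_eq_zero.mp h1 with h3 | h3
        · exact absurd (show a i ∈ O.carrier from hi) (by rw [h3]; exact ord_zero O)
        · exact mul_self_eq_zero.mp h3
      · exact hz s v hv i hi
  · rintro n ⟨U, rfl, hU⟩
    have hd : Disjoint U (Submodule.span K (b '' sᶜ)) := by
      rw [Submodule.disjoint_def]
      intro v hv hv'
      by_contra hv0
      have h1 := hU v hv hv0
      have h3 : -Q v = ∑ i, (-a i) * (b.repr v i * b.repr v i) := by
        rw [hQ]; simp
      have hterm : ∀ i ∈ Finset.univ, (-a i) * (b.repr v i * b.repr v i) ∈ O.carrier ∨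
          (-a i) * (b.repr v i * b.repr v i) = 0 := by
        intro i _
        by_cases h0 : b.repr v i = 0
        · right; simp [h0]
        · have hi : i ∉ s := fun hi => h0 (hz sᶜ v hv' i (by simpa using hi))
          by_cases ha : a i = 0
          · right; simp [ha]
          · left
            exact O.mul_mem' ((O.total' _ ha).resolve_left hi) (ord_sq O h0)
      rcases ord_sum O Finset.univ (fun i => (-a i) * (b.repr v i * b.repr v i)) hterm
        with h | ⟨h, _⟩
      · exact O.disjoint' _ h1 (by rw [h3]; exact h)
      · rw [h] at h3
        rw [neg_eq_zero.mp h3] at h1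
        exact ord_zero O h1
    have h1 := Submodule.finrank_add_finrank_le_of_disjoint hd
    rw [hfr, Module.finrank_eq_card_basis b, Set.toFinset_compl, Finset.card_compl] at h1
    have := Finset.card_le_univ s.toFinset
    omega

theorem sylv {K V ι : Type*} [Field K] [AddCommGroup V] [Module K V] [Fintype ι]
    (O : FieldOrdering K) (b : Module.Basis ι K V) (a : ι → K) (Q : V → K)
    (hQ : ∀ v, Q v = ∑ i, a i * (b.repr v i * b.repr v i)) :
    signatureAt O Q = ∑ i, osgn O (a i) := by
  classical
  unfold signatureAt
  rw [sylv_pos O b a Q hQ, sylv_pos O b (fun i => -a i) (fun v => -Q v) (fun v => by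
    rw [hQ]; simp)]
  rw [Finset.card_filter, Finset.card_filter, Nat.cast_sum, Nat.cast_sum,
    ← Finset.sum_sub_distrib]
  refine Finset.sum_congr rfl fun i _ => ?_
  unfold osgn
  by_cases h1 : a i ∈ O.carrier
  · have := O.disjoint' _ h1
    simp [h1, this]
  · by_cases h3 : -a i ∈ O.carrier <;> simp [h1, h3]

theorem sig_zero_of_anti {K V : Type*} [Field K] [AddCommGroup V] [Module K V]
    (O : FieldOrdering K) (Q : V → K) (τ : V ≃ₗ[K] V) (h : ∀ v, Q (τ v) = - Q v) :
    signatureAt O Q = 0 := by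
  unfold signatureAt
  rw [sub_eq_zero]
  congr 2
  ext n
  constructor
  · rintro ⟨U, hn, hU⟩
    refine ⟨U.map τ.toLinearMap, by rw [← hn]; exact LinearEquiv.finrank_map_eq τ U, ?_⟩
    rintro _ ⟨u, hu, rfl⟩ h0
    have : u ≠ 0 := by rintro rfl; simp at h0
    simpa [h] using hU u hu this
  · rintro ⟨U, hn, hU⟩
    refine ⟨U.map τ.toLinearMap, by rw [← hn]; exact LinearEquiv.finrank_map_eq τ U, ?_⟩
    rintro _ ⟨u, hu, rfl⟩ h0
    have : u ≠ 0 := by rintro rfl; simp at h0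
    simpa [h] using hU u hu this

theorem sig_zero_of_hypD {K ι : Type*} [Field K] [Fintype ι] (O : FieldOrdering K) (a : ι → K)
    (h : HypD a) : ∑ i, osgn O (a i) = 0 := by
  rw [← sylv O (Pi.basisFun K ι) a (dQ a) (fun v => by simp [dQ])]
  obtain ⟨U, W, hc, hU, hW⟩ := h
  let e := Submodule.prodEquivOfIsCompl U W hc
  let τ := (e.symm.trans ((LinearEquiv.refl K U).prodCongr (LinearEquiv.neg K))).trans e
  refine sig_zero_of_anti O _ τ fun v => ?_
  obtain ⟨⟨u, w⟩, rfl⟩ := e.surjective v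
  have h1 : e (u, w) = (u : ι → K) + w := by simp [e]
  have h3 : τ (e (u, w)) = (u : ι → K) - w := by simp [τ, e, sub_eq_add_neg]
  rw [h1] at h3 ⊢
  rw [h3]
  have key : ∀ x y : ι → K, dQ a (x - y) + dQ a (x + y) = 2 * (dQ a x + dQ a y) := fun x y => by
    simp only [dQ, ← Finset.sum_add_distrib, Finset.mul_sum]
    refine Finset.sum_congr rfl fun i _ => ?_
    simp only [Pi.add_apply, Pi.sub_apply]
    ring
  have := key u w
  rw [hU u u.2, hW w w.2] at this
  linear_combination this

theorem times_iff {K V ι : Type*} [Field K] [AddCommGroup V] [Module K V] [Fintype ι]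
    (b : Module.Basis ι K V) (a : ι → K) (Q : V → K)
    (hQ : ∀ v, Q v = ∑ i, a i * (b.repr v i * b.repr v i)) (n : ℕ) :
    IsHyperbolicQ (timesQ n Q) ↔ HypD (fun p : (Σ _ : Fin n, ι) => a p.2) := by
  let e := (Pi.basis fun _ : Fin n => b).equivFun
  have he : ∀ v, dQ (fun p : (Σ _ : Fin n, ι) => a p.2) (e v) = timesQ n Q v := fun v => by
    simp [dQ, timesQ, hQ, Fintype.sum_sigma, e, Pi.basis_repr]
  constructor
  · exact hyp_transport e he
  · refine hyp_transport e.symm fun v => ?_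
    rw [← he, e.apply_symm_apply]

theorem diag_exists {K V : Type*} [Field K] (h2 : (2 : K) ≠ 0)
    [AddCommGroup V] [Module K V] [FiniteDimensional K V]
    (B : LinearMap.BilinForm K V) (hB : B.IsSymm) :
    ∃ (d : ℕ) (b : Module.Basis (Fin d) K V) (a : Fin d → K),
      ∀ v, B v v = ∑ i, a i * (b.repr v i * b.repr v i) := by
  have := invertibleOfNonzero h2
  obtain ⟨b, hb⟩ := LinearMap.BilinForm.exists_orthogonal_basis
    (LinearMap.BilinForm.isSymm_iff.mp hB)
  refine ⟨_, b, fun i => B (b i) (b i), fun v => ?_⟩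
  conv_lhs => rw [← b.sum_repr v]
  simp only [map_sum, LinearMap.sum_apply, map_smul, LinearMap.smul_apply, smul_eq_mul]
  refine Finset.sum_congr rfl fun i _ => ?_
  rw [Finset.sum_eq_single i]
  · ring
  · intro j _ hji
    have : B (b j) (b i) = 0 := hb hji
    simp [this]
  · simp

theorem fam_times {K : Type*} {ι : Type} [Field K] [Fintype ι] (a : ι → K) (n : ℕ) :
    fam (fun p : (Σ _ : Fin n, ι) => a p.2) = (n : MonoidAlgebra ℤ K) * fam a := by
  simp [fam, Fintype.sum_sigma]

end Aux

/-- **Proposition (Pfister's local–global principle for possibly degenerate forms).**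
There is `n ≥ 1` with `n × q` hyperbolic iff `q` has signature `0` at every ordering of
`K`, and in that case the smallest such `n` is a power of `2`. -/
theorem statement3 {K V : Type*} [Field K] (hchar : (2 : K) ≠ 0)
    [AddCommGroup V] [Module K V] [FiniteDimensional K V]
    (B : LinearMap.BilinForm K V) (hB : B.IsSymm) :
    ((∃ n : ℕ, 0 < n ∧ IsHyperbolicQ (timesQ n fun v => B v v)) ↔
      ∀ O : FieldOrdering K, signatureAt O (fun v => B v v) = 0) ∧
    ((∃ n : ℕ, 0 < n ∧ IsHyperbolicQ (timesQ n fun v => B v v)) →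
      ∃ k : ℕ, IsLeast {n : ℕ | 0 < n ∧ IsHyperbolicQ (timesQ n fun v => B v v)} (2 ^ k)) := by
  obtain ⟨d, b, a, hQ⟩ := diag_exists hchar B hB
  have hit : ∀ n : ℕ, IsHyperbolicQ (timesQ n fun v => B v v) ↔
      (n : MonoidAlgebra ℤ K) * fam a ∈ hypIdeal K := fun n => by
    rw [times_iff b a _ hQ n, ← fam_times, fam_mem_iff hchar]
  have hsig : ∀ O : FieldOrdering K, signatureAt O (fun v => B v v) = ∑ i, osgn O (a i) :=
    fun O => sylv O b a _ hQ
  have fwd : (∃ n : ℕ, 0 < n ∧ IsHyperbolicQ (timesQ n fun v => B v v)) →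
      ∀ O : FieldOrdering K, signatureAt O (fun v => B v v) = 0 := by
    rintro ⟨n, hn, h⟩ O
    rw [hsig]
    have := sig_zero_of_hypD O _ ((times_iff b a _ hQ n).mp h)
    simp only [Fintype.sum_sigma, Finset.sum_const, Finset.card_univ, Fintype.card_fin,
      nsmul_eq_mul] at this
    exact (mul_eq_zero.mp this).resolve_left (by exact_mod_cast hn.ne')
  have bwd : (∀ O : FieldOrdering K, signatureAt O (fun v => B v v) = 0) →
      ∃ k : ℕ, ((2 ^ k : ℕ) : MonoidAlgebra ℤ K) * fam a ∈ hypIdeal K := by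
    intro h
    obtain ⟨k, hk⟩ := pfister_fam hchar a fun O => by rw [← hsig]; exact h O
    exact ⟨k, by rw [Nat.cast_pow, Nat.cast_ofNat]; exact hk⟩
  refine ⟨⟨fwd, fun h => ?_⟩, fun h => ?_⟩
  · obtain ⟨k, hk⟩ := bwd h
    exact ⟨2 ^ k, by positivity, (hit _).mpr hk⟩
  · classical
    have hex := bwd (fwd h)
    refine ⟨Nat.find hex, ⟨by positivity, (hit _).mpr (Nat.find_spec hex)⟩, ?_⟩
    rintro n ⟨hn, hyp⟩
    rw [hit] at hyp
    have hk := Nat.find_spec hex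
    set k := Nat.find hex with hkdef
    have hg : ((Nat.gcd n (2 ^ k) : ℕ) : MonoidAlgebra ℤ K) * fam a ∈ hypIdeal K := by
      have hbz := congrArg (Int.cast : ℤ → MonoidAlgebra ℤ K) (Nat.gcd_eq_gcd_ab n (2 ^ k))
      rw [Int.cast_natCast] at hbz
      rw [hbz]
      have e := (hypIdeal K).add_mem
        ((hypIdeal K).mul_mem_left ((Nat.gcdA n (2 ^ k) : ℤ) : MonoidAlgebra ℤ K) hyp)
        ((hypIdeal K).mul_mem_left ((Nat.gcdB n (2 ^ k) : ℤ) : MonoidAlgebra ℤ K) hk)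
      convert e using 1
      push_cast
      ring
    obtain ⟨j, hj, hje⟩ := (Nat.dvd_prime_pow Nat.prime_two).mp (Nat.gcd_dvd_right n (2 ^ k))
    rw [hje] at hg
    have hkj : k ≤ j := Nat.find_min' hex hg
    have hjk : j = k := le_antisymm hj hkj
    subst hjk
    exact Nat.le_of_dvd hn (hje ▸ Nat.gcd_dvd_left n _)
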